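/- Let λ ∈ 𝕏^∨ and let x, y ∈ W_{aff,λ}\W_aff be two distinct cosets. Then there exists at most one reflection t ∈ W_aff such that xt = y. -/

import Mathlib

noncomputable section

open Function Set

/-- An abstract interface for the set `𝒜` of alcoves of a finite root datum
`(𝕏, Φ', 𝕏^∨, (Φ')^∨)` with a chosen positive system `(Φ')⁺` (indexed by `PR`):
`V = 𝕏^∨ ⊗ ℝ` is the ambient space, `cowt` is the image of the coweight lattice
`𝕏^∨`, `pts a ⊆ V` is the alcove `a` as a subset (a connected component of the
complement of the hyperplanes `⟨α,·⟩ = n`), `refl α n` is the affine reflection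
`s_{(α,n)}` acting on alcoves, `transl a μ = a + μ` is translation, and the
partial order on `A` is the generic order generated by `A < α↑A`. -/
structure AlcoveSystem (V : Type) [AddCommGroup V] [Module ℝ V] [TopologicalSpace V]
    (PR : Type) [Finite PR] (A : Type) [PartialOrder A] where
  root : PR → V →ₗ[ℝ] ℝ
  coroot : PR → V
  root_coroot_two : ∀ α, root α (coroot α) = 2
  cowt : AddSubgroup V
  coroot_mem : ∀ α, coroot α ∈ cowt
  root_int : ∀ (α : PR) (v : V), v ∈ cowt → ∃ k : ℤ, root α v = (k : ℝ)
  /-- the half-sum of positive coroots lies in `𝕏^∨` -/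
  half_sum_coroots_mem : ∃ ρv ∈ cowt, (2 : ℝ) • ρv = ∑ᶠ α : PR, coroot α
  pts : A → Set V
  pts_injective : Function.Injective pts
  pts_nonempty : ∀ a, (pts a).Nonempty
  pts_off_walls : ∀ (a : A), ∀ v ∈ pts a, ∀ (α : PR) (k : ℤ), root α v ≠ (k : ℝ)
  refl : PR → ℤ → A → A
  refl_pts : ∀ α n a,
    pts (refl α n a) = (fun v => v - (root α v + (n : ℝ)) • coroot α) '' pts a
  transl : A → cowt → A
  transl_pts : ∀ (a) (μ : cowt), pts (transl a μ) = (fun v => v + (μ : V)) '' pts a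
  /-- the order on alcoves is generated by `A < α↑A`, where `α↑A = s_{(α,n)}A` for
  the unique `n` with `-1 < ⟨α,λ⟩ + n < 0` for all `λ ∈ A`. -/
  le_iff : ∀ a b : A, a ≤ b ↔
    Relation.ReflTransGen
      (fun a' b' => ∃ (α : PR) (n : ℤ),
        (∀ v ∈ pts a', -1 < root α v + (n : ℝ) ∧ root α v + (n : ℝ) < 0) ∧
        b' = refl α n a') a b

namespace AlcoveSystem

variable {V : Type} [AddCommGroup V] [Module ℝ V] [TopologicalSpace V]
variable {PR : Type} [Finite PR] {A : Type} [PartialOrder A]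

/-- The (open) dominant cone `{v | ⟨α,v⟩ > 0 for all α ∈ (Φ')⁺}`. -/
def domCone (S : AlcoveSystem V PR A) : Set V := {v : V | ∀ α : PR, 0 < S.root α v}

/-- A dominant alcove: an element of `𝒜⁺`. -/
def IsDominant (S : AlcoveSystem V PR A) (a : A) : Prop := S.pts a ⊆ S.domCone

end AlcoveSystem

/-- The affine Weyl group `(W_aff, S_aff)` of wall-crossings: a Coxeter system
(`cs.simple b`, `b : Bi`, are the simple reflections `S_aff`) acting simply
transitively on the set of alcoves on the right, each wall-crossing `A ↦ As`
being induced by an affine reflection. -/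
structure AlcoveCoxeter (V : Type) [AddCommGroup V] [Module ℝ V] [TopologicalSpace V]
    (PR : Type) [Finite PR] (A : Type) [PartialOrder A]
    (Bi : Type) (W : Type) [Group W]
    extends AlcoveSystem V PR A where
  M : CoxeterMatrix Bi
  cs : CoxeterSystem M W
  ract : A → W → A
  ract_one : ∀ a : A, ract a 1 = a
  ract_mul : ∀ (a : A) (x y : W), ract a (x * y) = ract (ract a x) y
  ract_simply_transitive : ∀ a b : A, ∃! x : W, ract a x = b
  /-- each simple wall-crossing is induced by an affine reflection of `V` -/
  simple_is_reflection : ∀ (b : Bi) (a : A), ∃ (α : PR) (n : ℤ), ract a (cs.simple b) = refl α n a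
  simple_moves : ∀ (b : Bi) (a : A), ract a (cs.simple b) ≠ a

namespace AlcoveCoxeter

variable {V : Type} [AddCommGroup V] [Module ℝ V] [TopologicalSpace V]
variable {PR : Type} [Finite PR] {A : Type} [PartialOrder A]
variable {Bi : Type} {W : Type} [Group W]

/-- The Bruhat order on `W_aff`: generated by `w < wt` for reflections `t` with
`ℓ(wt) > ℓ(w)`. -/
def bruhatLE (C : AlcoveCoxeter V PR A Bi W) (w w' : W) : Prop :=
  Relation.ReflTransGen
    (fun u u' => (∃ t : W, C.cs.IsReflection t ∧ u' = u * t) ∧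
      C.cs.length u < C.cs.length u') w w'

/-- The strict Bruhat order on `W_aff`. -/
def bruhatLT (C : AlcoveCoxeter V PR A Bi W) (w w' : W) : Prop :=
  C.bruhatLE w w' ∧ w ≠ w'

/-- `S_{aff,λ}`: the set of simple reflections `s` such that some face of type `s`
contains `λ` in its closure (equivalently, `λ` lies in the closure of both `A` and
`As` for some alcove `A`). -/
def Ssub (C : AlcoveCoxeter V PR A Bi W) (μ : V) : Set Bi :=
  {b : Bi | ∃ a : A,
    μ ∈ closure (C.pts a) ∧ μ ∈ closure (C.pts (C.ract a (C.cs.simple b)))}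

/-- The standard parabolic subgroup `W_{aff,λ}` generated by `S_{aff,λ}`. -/
def Wsub (C : AlcoveCoxeter V PR A Bi W) (μ : V) : Subgroup W :=
  Subgroup.closure (C.cs.simple '' C.Ssub μ)

/-- `^λW_aff`: the set of minimal length representatives of `W_{aff,λ}\W_aff`. -/
def minReps (C : AlcoveCoxeter V PR A Bi W) (μ : V) : Set W :=
  {w : W | ∀ u ∈ C.Wsub μ, C.cs.length w ≤ C.cs.length (u * w)}

end AlcoveCoxeter

theorem functionEnd_one_apply {α : Type*} (x : α) : (1 : Function.End α) x = x := rfl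

theorem functionEnd_mul_apply {α : Type*} (f g : Function.End α) (x : α) : (f * g) x = f (g x) := rfl

namespace CoxeterSystem

variable {B W : Type*} [Group W] {M : CoxeterMatrix B} (cs : CoxeterSystem M W)

open Classical in
/-- The action of the simple reflection `sᵢ` on `W × ℤ/2`: conjugate the first coordinate, and
flip the second one exactly when the first one is `sᵢ`. -/
def signedConj (i : B) : Function.End (W × ZMod 2) := fun p =>
  (cs.simple i * p.1 * (cs.simple i)⁻¹, p.2 + if p.1 = cs.simple i then 1 else 0)

open Classical in
theorem signedConj_mul_pow_apply (i j : B) (n : ℕ) (p : W × ZMod 2) :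
    ((cs.signedConj i * cs.signedConj j) ^ n) p =
      ((cs.simple i * cs.simple j) ^ n * p.1 * ((cs.simple i * cs.simple j) ^ n)⁻¹,
        p.2 + ∑ q ∈ Finset.range (2 * n),
          if p.1 = cs.simple j * (cs.simple i * cs.simple j) ^ q then 1 else 0) := by
  induction n with
  | zero => simp [functionEnd_one_apply]
  | succ n ih =>
    have hj : (cs.simple j)⁻¹ = cs.simple j := cs.inv_simple j
    have hi : (cs.simple i)⁻¹ = cs.simple i := cs.inv_simple i
    set r := cs.simple i * cs.simple j with hr
    have hrj : r * cs.simple j = cs.simple j * r⁻¹ := by simp [hr, hi, hj]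
    have hrj' (k : ℕ) : r ^ k * cs.simple j = cs.simple j * (r ^ k)⁻¹ := by
      rw [← inv_pow]
      exact SemiconjBy.pow_right (a := cs.simple j) (x := r⁻¹) (y := r) hrj.symm k |>.symm
    have hrj_inv : (r ^ n)⁻¹ * cs.simple j = cs.simple j * r ^ n := by
      rw [inv_mul_eq_iff_eq_mul, ← mul_assoc, hrj', inv_mul_cancel_right]
    have h₁ : (r ^ n * p.1 * (r ^ n)⁻¹ = cs.simple j) ↔ p.1 = cs.simple j * r ^ (2 * n) := by
      rw [mul_inv_eq_iff_eq_mul, ← eq_inv_mul_iff_mul_eq, two_mul, pow_add, ← mul_assoc,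
        ← mul_assoc, hrj_inv]
    have h₂ : (cs.simple j * (r ^ n * p.1 * (r ^ n)⁻¹) * (cs.simple j)⁻¹ = cs.simple i) ↔
        p.1 = cs.simple j * r ^ (2 * n + 1) := by
      rw [mul_inv_eq_iff_eq_mul, ← eq_inv_mul_iff_mul_eq, mul_inv_eq_iff_eq_mul,
        ← eq_inv_mul_iff_mul_eq, hj, ← hr, ← mul_assoc, ← mul_assoc, hrj_inv]
      have : cs.simple j * r ^ n * r * r ^ n = cs.simple j * r ^ (2 * n + 1) := by
        simp only [mul_assoc, ← pow_succ', ← pow_add]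
        congr 2
        ring
      rw [this]
    rw [pow_succ', functionEnd_mul_apply, ih]
    simp only [functionEnd_mul_apply, signedConj, h₁, h₂]
    ext
    · simp only [hr, pow_succ', mul_inv_rev, mul_assoc]
    · rw [show 2 * (n + 1) = 2 * n + 1 + 1 by ring, Finset.sum_range_succ, Finset.sum_range_succ]
      simp only [add_assoc]

theorem isLiftable_signedConj : M.IsLiftable cs.signedConj := by
  intro i j
  classical
  funext p
  rw [signedConj_mul_pow_apply, two_mul, Finset.sum_range_add]
  simp only [pow_add, cs.simple_mul_simple_pow i j, one_mul, CharTwo.add_self_eq_zero]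
  simp [functionEnd_one_apply]

/-- The conjugation action of `W` on itself, together with the sign recording inversions. -/
def signedConjHom : W →* Function.End (W × ZMod 2) :=
  cs.lift ⟨cs.signedConj, cs.isLiftable_signedConj⟩

/-- The parity of the number of occurrences of `t` in the right inversion sequence of any word
for `w`. -/
def inversionParity (w t : W) : ZMod 2 := (cs.signedConjHom w (t, 0)).2

theorem signedConjHom_simple (i : B) : cs.signedConjHom (cs.simple i) = cs.signedConj i :=
  cs.lift_apply_simple _ i

theorem signedConjHom_apply (w t : W) (e : ZMod 2) :
    cs.signedConjHom w (t, e) = (w * t * w⁻¹, e + cs.inversionParity w t) := by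
  suffices h : ∀ w : W, ∃ η : W → ZMod 2,
      ∀ t e, cs.signedConjHom w (t, e) = (w * t * w⁻¹, e + η t) by
    obtain ⟨η, hη⟩ := h w
    simp [inversionParity, hη]
  intro w
  induction w using cs.simple_induction_left with
  | one => exact ⟨0, by simp [functionEnd_one_apply]⟩
  | mul_simple_left w i ih =>
    obtain ⟨η, hη⟩ := ih
    classical
    refine ⟨fun t => η t + if w * t * w⁻¹ = cs.simple i then 1 else 0, fun t e => ?_⟩
    rw [map_mul, functionEnd_mul_apply, hη, signedConjHom_simple]
    simp [signedConj, mul_assoc, add_assoc]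

theorem inversionParity_one (t : W) : cs.inversionParity 1 t = 0 := by
  simp [inversionParity, functionEnd_one_apply]

theorem inversionParity_mul (u v t : W) :
    cs.inversionParity (u * v) t =
      cs.inversionParity v t + cs.inversionParity u (v * t * v⁻¹) := by
  rw [inversionParity, map_mul, functionEnd_mul_apply, signedConjHom_apply,
    signedConjHom_apply, zero_add]

open Classical in
theorem inversionParity_simple (i : B) (t : W) :
    cs.inversionParity (cs.simple i) t = if t = cs.simple i then 1 else 0 := by
  simp [inversionParity, signedConjHom_simple, signedConj]

theorem IsReflection.inversionParity_self {t : W} (ht : cs.IsReflection t) :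
    cs.inversionParity t t = 1 := by
  obtain ⟨w, i, rfl⟩ := ht
  have h := cs.inversionParity_mul w w⁻¹ (w * cs.simple i * w⁻¹)
  rw [mul_inv_cancel, inversionParity_one] at h
  rw [mul_assoc w, inversionParity_mul, inversionParity_mul, inversionParity_simple]
  simp only [mul_assoc, inv_mul_cancel_left, mul_inv_rev, inv_inv, inv_mul_cancel, mul_one,
    inv_simple, simple_mul_simple_self, if_true] at h ⊢
  rw [add_right_comm, ← h, zero_add]

/-- Strong exchange: a reflection of odd parity occurs in every right inversion sequence. -/
theorem mem_rightInvSeq_of_inversionParity_ne_zero {ω : List B} {t : W}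
    (h : cs.inversionParity (cs.wordProd ω) t ≠ 0) : t ∈ cs.rightInvSeq ω := by
  induction ω with
  | nil => simp [inversionParity_one] at h
  | cons i ω ih =>
    rw [wordProd_cons, inversionParity_mul, inversionParity_simple] at h
    rw [rightInvSeq, List.mem_cons]
    by_cases hi : cs.wordProd ω * t * (cs.wordProd ω)⁻¹ = cs.simple i
    · left
      rw [← hi]
      group
    · right
      simp only [hi, if_false, add_zero] at h
      exact ih h

theorem inversionParity_eq_zero_of_mem_closure {J : Set B} {u t : W}
    (hu : u ∈ Subgroup.closure (cs.simple '' J)) (ht : t ∉ Subgroup.closure (cs.simple '' J)) :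
    cs.inversionParity u t = 0 := by
  have conj_notMem {v t : W} (hv : v ∈ Subgroup.closure (cs.simple '' J))
      (ht : t ∉ Subgroup.closure (cs.simple '' J)) :
      v * t * v⁻¹ ∉ Subgroup.closure (cs.simple '' J) := by
    rwa [Subgroup.mul_mem_cancel_right _ (inv_mem hv), Subgroup.mul_mem_cancel_left _ hv]
  induction hu using Subgroup.closure_induction generalizing t with
  | mem x hx =>
    obtain ⟨i, hi, rfl⟩ := hx
    rw [inversionParity_simple, if_neg]
    rintro rfl
    exact ht (Subgroup.subset_closure (mem_image_of_mem _ hi))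
  | one => exact cs.inversionParity_one t
  | mul x y hx hy ihx ihy =>
    rw [inversionParity_mul, ihy ht, ihx (conj_notMem hy ht), add_zero]
  | inv x hx ih =>
    have h := cs.inversionParity_mul x x⁻¹ t
    rwa [mul_inv_cancel, inversionParity_one, ih (conj_notMem (inv_mem hx) ht), add_zero,
      eq_comm] at h

theorem length_conj_le (ω : List B) (i : B) :
    cs.length (cs.wordProd ω * cs.simple i * (cs.wordProd ω)⁻¹) ≤ 2 * ω.length + 1 := by
  calc
    _ = cs.length (cs.wordProd (ω ++ [i] ++ ω.reverse)) := by
      simp [wordProd_append, wordProd_cons, mul_assoc]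
    _ ≤ _ := cs.length_wordProd_le _
    _ = 2 * ω.length + 1 := by simp; ring

theorem length_getElem_rightInvSeq_le (ω : List B) (j : ℕ) (hj : j < ω.length) :
    cs.length ((cs.rightInvSeq ω)[j]'(by simpa)) ≤ 2 * (ω.length - (j + 1)) + 1 := by
  rw [cs.getElem_rightInvSeq ω j hj]
  have h := cs.length_conj_le (ω.drop (j + 1)).reverse ω[j]
  simpa [hj] using h

theorem length_conj_getElem_rightInvSeq_le (ω : List B) (j : ℕ) (hj : j < ω.length) :
    cs.length (cs.wordProd ω * (cs.rightInvSeq ω)[j]'(by simpa) * (cs.wordProd ω)⁻¹) ≤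
      2 * j + 1 := by
  have h := cs.length_conj_le (ω.take j) ω[j]
  rw [List.length_take_of_le hj.le] at h
  convert h using 2
  rw [cs.getElem_rightInvSeq ω j hj]
  have hω : cs.wordProd ω =
      cs.wordProd (ω.take j) * (cs.simple ω[j] * cs.wordProd (ω.drop (j + 1))) := by
    rw [← wordProd_cons, ← wordProd_append, ← List.drop_eq_getElem_cons, List.take_append_drop]
  rw [hω]
  simp [hj, mul_assoc]

/-- Two reflections outside a standard parabolic subgroup whose product lies in it are equal. -/
theorem IsReflection.eq_of_mul_mem_closure {J : Set B} {t t' : W}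
    (ht : cs.IsReflection t) (ht' : cs.IsReflection t')
    (hJ : t ∉ Subgroup.closure (cs.simple '' J)) (hJ' : t' ∉ Subgroup.closure (cs.simple '' J))
    (h : t * t' ∈ Subgroup.closure (cs.simple '' J)) : t = t' := by
  induction hn : cs.length t using Nat.strong_induction_on generalizing t t' with
  | _ n ih =>
  subst hn
  by_contra hne
  have h' : t' * t ∈ Subgroup.closure (cs.simple '' J) := by
    simpa [ht.inv, ht'.inv] using inv_mem h
  have hle : cs.length t ≤ cs.length t' := by
    by_contra! hlt
    exact hne (ih _ hlt ht' ht hJ' hJ h' rfl).symm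
  have hle' : cs.length t ≤ cs.length (t * t' * t⁻¹) := by
    by_contra! hlt
    have := ih _ hlt (ht'.conj t) ht
      (by rwa [ht.inv, Subgroup.mul_mem_cancel_left _ h]) hJ (by simpa using h) rfl
    rw [mul_inv_eq_iff_eq_mul] at this
    exact hne (mul_left_cancel this).symm
  have hpar : cs.inversionParity t t' ≠ 0 := by
    have := cs.inversionParity_mul (t * t') t' t'
    rw [mul_assoc, ht'.mul_self, mul_one, ht'.inversionParity_self, one_mul, ht'.inv,
      cs.inversionParity_eq_zero_of_mem_closure h hJ', add_zero] at this
    simp [this]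
  obtain ⟨ω, hω, rfl⟩ := cs.exists_isReduced t
  obtain ⟨j, hj, hjt⟩ := List.mem_iff_getElem.mp <|
    cs.mem_rightInvSeq_of_inversionParity_ne_zero (ω := ω) (t := cs.wordProd ω)
      (by simp [ht.inversionParity_self])
  obtain ⟨k, hk, hkt⟩ := List.mem_iff_getElem.mp <|
    cs.mem_rightInvSeq_of_inversionParity_ne_zero hpar
  have hj' : j < ω.length := by simpa using hj
  have hk' : k < ω.length := by simpa using hk
  have hj₁ := cs.length_getElem_rightInvSeq_le ω j hj'
  have hj₂ := cs.length_conj_getElem_rightInvSeq_le ω j hj'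
  have hk₁ := cs.length_getElem_rightInvSeq_le ω k hk'
  have hk₂ := cs.length_conj_getElem_rightInvSeq_le ω k hk'
  rw [hjt] at hj₁ hj₂
  rw [hkt] at hk₁ hk₂
  rw [mul_inv_cancel_right] at hj₂
  have hlen : cs.length (cs.wordProd ω) = ω.length := hω
  obtain rfl : j = k := by omega
  exact hne (hjt.symm.trans hkt)

end CoxeterSystem

open AlcoveCoxeter in
/-- **Statement 6**.
Let `λ ∈ 𝕏^∨` and let `x, y ∈ W_{aff,λ}\W_aff` be two distinct right cosets
(represented by `w, w' ∈ W_aff`; distinctness means `w ∉ W_{aff,λ} w'`).  Then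
there is at most one reflection `t ∈ W_aff` with `xt = y` (i.e. with
`wt ∈ W_{aff,λ} w'`). -/
theorem at_most_one_reflection_between_cosets
    {V : Type} [AddCommGroup V] [Module ℝ V] [TopologicalSpace V]
    {PR : Type} [Finite PR] {A : Type} [PartialOrder A]
    {Bi : Type} {W : Type} [Group W]
    (C : AlcoveCoxeter V PR A Bi W) (lam : C.cowt)
    (w w' : W) (hne : ∀ u ∈ C.Wsub (lam : V), u * w' ≠ w)
    (t₁ t₂ : W) (ht₁ : C.cs.IsReflection t₁) (ht₂ : C.cs.IsReflection t₂)
    (h₁ : ∃ u ∈ C.Wsub (lam : V), w * t₁ = u * w')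
    (h₂ : ∃ u ∈ C.Wsub (lam : V), w * t₂ = u * w') :
    t₁ = t₂ := by
  obtain ⟨u₁, hu₁, h₁⟩ := h₁
  obtain ⟨u₂, hu₂, h₂⟩ := h₂
  have notMem {t u : W} (hu : u ∈ C.Wsub (lam : V)) (h : w * t = u * w') :
      w * t⁻¹ * w⁻¹ ∉ C.Wsub (lam : V) := fun hmem => by
    refine hne _ (mul_mem hmem hu) ?_
    rw [mul_assoc, ← h]
    group
  have key : w * t₁ * w⁻¹ = w * t₂ * w⁻¹ := by
    refine CoxeterSystem.IsReflection.eq_of_mul_mem_closure C.cs (J := C.Ssub lam)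
      (ht₁.conj w) (ht₂.conj w) ?_ ?_ ?_
    · simpa only [ht₁.inv, Wsub] using notMem hu₁ h₁
    · simpa only [ht₂.inv, Wsub] using notMem hu₂ h₂
    · have : w * t₁ * w⁻¹ * (w * t₂ * w⁻¹) = u₁ * u₂⁻¹ := by
        calc
          _ = w * t₁ * (w * t₂)⁻¹ := by rw [mul_inv_rev, ht₂.inv]; group
          _ = u₁ * u₂⁻¹ := by rw [h₁, h₂]; group
      rw [this]
      exact mul_mem hu₁ (inv_mem hu₂)
  exact mul_left_cancel (mul_right_cancel key)
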